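/- (Dobrushin's condition / asymmetric LLL for the independent set polynomial) Let G be a finite simple graph on vertex set [n] with neighborhoods Γ_i, and let p ∈ [0,1)^n. If there exist r_1, …, r_n ∈ [0,1) such that p_i ≤ r_i · ∏_{j∈Γ_i} (1 − r_j) for all i ∈ [n], then Z_G(−p; S) ≥ ∏_{i∈S} (1 − r_i) > 0 for every S ⊆ [n]. -/

import Mathlib

open Finset

variable {n : ℕ}

open Classical in
/-- Independent set polynomial of the subgraph of `G` induced by `S`, i.e. `Z_G(x; S)`. -/
noncomputable def Zpoly (G : SimpleGraph (Fin n)) (x : Fin n → ℝ) (S : Finset (Fin n)) : ℝ :=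
  ∑ I ∈ S.powerset.filter (fun I => ∀ a ∈ I, ∀ b ∈ I, ¬ G.Adj a b), ∏ i ∈ I, x i

open Classical in
theorem Zpoly_empty (G : SimpleGraph (Fin n)) (x : Fin n → ℝ) : Zpoly G x ∅ = 1 := by
  simp [Zpoly, Finset.filter_singleton]

open Classical in
/-- Deletion recurrence for the independent set polynomial at a vertex `a`. -/
theorem Zpoly_insert (G : SimpleGraph (Fin n)) (x : Fin n → ℝ) {S : Finset (Fin n)} {a : Fin n}
    (ha : a ∉ S) :
    Zpoly G x (insert a S) = Zpoly G x S + x a * Zpoly G x (S.filter fun j => ¬ G.Adj a j) := by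
  simp only [Zpoly, Finset.sum_filter]
  rw [Finset.sum_powerset_insert ha]
  congr 1
  rw [Finset.mul_sum]
  symm
  have hsub : (S.filter fun j => ¬ G.Adj a j).powerset ⊆ S.powerset :=
    Finset.powerset_mono.2 (Finset.filter_subset _ _)
  rw [← Finset.sum_subset hsub]
  · refine Finset.sum_congr rfl fun I hI => ?_
    have hI' : ∀ j ∈ I, j ∈ S ∧ ¬ G.Adj a j := fun j hj =>
      Finset.mem_filter.1 (Finset.mem_powerset.1 hI hj)
    have haI : a ∉ I := fun h => ha (hI' a h).1
    have hiff : (∀ b ∈ insert a I, ∀ c ∈ insert a I, ¬ G.Adj b c) ↔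
        ∀ b ∈ I, ∀ c ∈ I, ¬ G.Adj b c := by
      refine ⟨fun h b hb c hc => h b (mem_insert_of_mem hb) c (mem_insert_of_mem hc), ?_⟩
      intro h b hb c hc
      rcases mem_insert.1 hb with rfl | hbI <;> rcases mem_insert.1 hc with rfl | hcI
      · exact G.irrefl
      · exact (hI' c hcI).2
      · exact fun hadj => (hI' b hbI).2 hadj.symm
      · exact h b hbI c hcI
    rw [if_congr hiff rfl rfl, Finset.prod_insert haI, mul_ite, mul_zero]
  · intro I hIS hI
    refine if_neg fun h => hI (Finset.mem_powerset.2 fun j hj => Finset.mem_filter.2 ?_)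
    exact ⟨Finset.mem_powerset.1 hIS hj,
      h a (mem_insert_self a I) j (mem_insert_of_mem hj)⟩

/-- A set function growing by a factor of at least `w a` whenever an element `a` is added grows
by at least the product of these factors. -/
theorem prod_mul_le_union {α : Type*} [DecidableEq α] {f : Finset α → ℝ} {w : α → ℝ}
    (hw : ∀ a, 0 ≤ w a) {S : Finset α}
    (hf : ∀ U a, a ∉ U → insert a U ⊆ S → w a * f U ≤ f (insert a U))
    (T D : Finset α) (hTD : Disjoint T D) (hS : T ∪ D ⊆ S) :
    (∏ i ∈ D, w i) * f T ≤ f (T ∪ D) := by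
  induction D using Finset.induction_on with
  | empty => simp
  | insert a D ha ih =>
    rw [Finset.disjoint_insert_right] at hTD
    rw [Finset.union_insert] at hS ⊢
    rw [Finset.prod_insert ha, mul_assoc]
    calc w a * ((∏ i ∈ D, w i) * f T) ≤ w a * f (T ∪ D) :=
          mul_le_mul_of_nonneg_left (ih hTD.2 ((subset_insert _ _).trans hS)) (hw a)
      _ ≤ f (insert a (T ∪ D)) := hf _ _ (by simp [hTD.1, ha]) hS

open Classical in
/-- Under Dobrushin's condition, adding a vertex `a` decreases `Z_G(-p; ·)` at most by the
factor `1 - r a`. -/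
theorem one_sub_mul_Zpoly_le (G : SimpleGraph (Fin n)) {p r : Fin n → ℝ}
    (hr : ∀ i, 0 ≤ r i ∧ r i < 1)
    (hcond : ∀ i, p i ≤ r i * ∏ j : Fin n, if G.Adj i j then 1 - r j else 1)
    (S : Finset (Fin n)) (a : Fin n) (ha : a ∉ S) :
    (1 - r a) * Zpoly G (fun i => -p i) S ≤ Zpoly G (fun i => -p i) (insert a S) := by
  induction S using Finset.strongInduction generalizing a with
  | H S ih =>
    have hw : ∀ i, 0 ≤ 1 - r i := fun i => sub_nonneg.2 (hr i).2.le
    have step : ∀ U b, b ∉ U → insert b U ⊆ S →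
        (1 - r b) * Zpoly G (fun i => -p i) U ≤ Zpoly G (fun i => -p i) (insert b U) :=
      fun U b hb hU => ih U ((ssubset_insert hb).trans_subset hU) b hb
    rw [Zpoly_insert G _ ha]
    set T := S.filter fun j => ¬ G.Adj a j with hT
    have hTS : T ⊆ S := Finset.filter_subset _ _
    have hTnonneg : 0 ≤ Zpoly G (fun i => -p i) T := by
      have h := prod_mul_le_union hw step ∅ T (disjoint_empty_left T) (by simpa using hTS)
      rw [Zpoly_empty, mul_one, empty_union] at h
      exact (Finset.prod_nonneg fun i _ => hw i).trans h
    have hunion : T ∪ S.filter (G.Adj a) = S := by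
      rw [union_comm, hT, Finset.filter_union_filter_not_eq]
    have hgrow := prod_mul_le_union hw step T (S.filter (G.Adj a))
      (Finset.disjoint_filter_filter_not _ _ _).symm hunion.le
    rw [hunion] at hgrow
    have hprod : (∏ j : Fin n, if G.Adj a j then 1 - r j else 1) ≤
        ∏ j ∈ S.filter (G.Adj a), (1 - r j) := by
      rw [← Finset.prod_filter]
      exact Finset.prod_le_prod_of_subset_of_le_one
        (Finset.filter_subset_filter _ (subset_univ S)) (fun i _ => hw i)
        fun i _ _ => sub_le_self _ (hr i).1
    have key : p a * Zpoly G (fun i => -p i) T ≤ r a * Zpoly G (fun i => -p i) S :=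
      calc p a * Zpoly G (fun i => -p i) T
          ≤ (r a * ∏ j ∈ S.filter (G.Adj a), (1 - r j)) * Zpoly G (fun i => -p i) T :=
            mul_le_mul_of_nonneg_right
              ((hcond a).trans (mul_le_mul_of_nonneg_left hprod (hr a).1)) hTnonneg
        _ ≤ r a * Zpoly G (fun i => -p i) S := by
            rw [mul_assoc]
            exact mul_le_mul_of_nonneg_left hgrow (hr a).1
    linarith

open Classical in
/-- **Dobrushin's condition.** If there are `r_i ∈ [0,1)` with
`p_i ≤ r_i ∏_{j ∈ Γ_i} (1 - r_j)` for all `i ∈ [n]`, then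
`Z_G(-p; S) ≥ ∏_{i ∈ S} (1 - r_i) > 0` for every `S ⊆ [n]`. -/
theorem dobrushin_condition (G : SimpleGraph (Fin n)) (p : Fin n → ℝ)
    (hp : ∀ i, 0 ≤ p i ∧ p i < 1)
    (r : Fin n → ℝ) (hr : ∀ i, 0 ≤ r i ∧ r i < 1)
    (hcond : ∀ i, p i ≤ r i * ∏ j : Fin n, if G.Adj i j then 1 - r j else 1) :
    ∀ S : Finset (Fin n),
      (∏ i ∈ S, (1 - r i)) ≤ Zpoly G (fun i => -p i) S ∧ 0 < ∏ i ∈ S, (1 - r i) := by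
  intro S
  refine ⟨?_, Finset.prod_pos fun i _ => sub_pos.2 (hr i).2⟩
  have h := prod_mul_le_union (fun i => sub_nonneg.2 (hr i).2.le)
    (fun U a ha _ => one_sub_mul_Zpoly_le G hr hcond U a ha) ∅ S (disjoint_empty_left S)
    (subset_refl _)
  rwa [Zpoly_empty, mul_one, empty_union] at h
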